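/- Let N ≥ 1, let v : ℝ × ℝ^N → ℝ^N be continuously differentiable with ∑_{i=1}^N ∂_{x_i} v_i(t,x) = 0 for all (t,x), and let x : ℝ × ℝ^N → ℝ^N be twice continuously differentiable with ∂_t x(t,y) = v(t, x(t,y)) and x(0,y) = y. Then for every (t,y) the Jacobian matrix J(t,y) := D_y x(t,y) is invertible, its inverse equals adjugate(J(t,y)), and consequently, with Q_{ij} the cofactor polynomials, (J(t,y)^{-1})_{ij} = δ_{ij} + Q_{ij}( J(t,y) − I_N ) for all i,j ∈ {1,…,N}. -/

import Mathlib

open scoped BigOperators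

theorem hasDerivAt_det_aux {N : ℕ} (M : ℝ → Matrix (Fin N) (Fin N) ℝ)
    (M' A : Matrix (Fin N) (Fin N) ℝ) (t : ℝ)
    (h : ∀ i j, HasDerivAt (fun s => M s i j) (M' i j) t)
    (hA : M' = A * M t) :
    HasDerivAt (fun s => (M s).det) (A.trace * (M t).det) t := by
  have h1 : ∀ M : Matrix (Fin N) (Fin N) ℝ, M.det =
      ∑ σ : Equiv.Perm (Fin N), ((Equiv.Perm.sign σ : ℤ) : ℝ) * ∏ i, M i (σ i) := by
    intro M
    rw [← Matrix.det_transpose, Matrix.det_apply']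
    rfl
  have h2 : HasDerivAt (fun s => ∑ σ : Equiv.Perm (Fin N),
      ((Equiv.Perm.sign σ : ℤ) : ℝ) * ∏ i, M s i (σ i))
      (∑ σ : Equiv.Perm (Fin N), ((Equiv.Perm.sign σ : ℤ) : ℝ) *
        ∑ i, (∏ j ∈ Finset.univ.erase i, M t j (σ j)) • M' i (σ i)) t := by
    apply HasDerivAt.fun_sum
    intro σ _
    apply HasDerivAt.const_mul
    exact HasDerivAt.fun_finsetProd (fun i _ => h i (σ i))
  have h3 : (∑ σ : Equiv.Perm (Fin N), ((Equiv.Perm.sign σ : ℤ) : ℝ) *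
        ∑ i, (∏ j ∈ Finset.univ.erase i, M t j (σ j)) • M' i (σ i))
      = ∑ i, ((M t).updateRow i (M' i)).det := by
    simp_rw [h1, Finset.mul_sum]
    rw [Finset.sum_comm]
    refine Finset.sum_congr rfl fun i _ => Finset.sum_congr rfl fun σ _ => ?_
    congr 1
    rw [← Finset.prod_erase_mul _ _ (Finset.mem_univ i), smul_eq_mul]
    congr 1
    · refine Finset.prod_congr rfl fun j hj => ?_
      rw [Matrix.updateRow_ne (Finset.ne_of_mem_erase hj)]
    · rw [Matrix.updateRow_self]
  have h4 : ∀ i, ((M t).updateRow i (M' i)).det = A i i * (M t).det := by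
    intro i
    have : M' i = ∑ k, A i k • M t k := by
      ext j
      simp [hA, Matrix.mul_apply]
    rw [this, Matrix.det_updateRow_sum, smul_eq_mul]
  rw [h3] at h2
  simp_rw [h4, ← Finset.sum_mul] at h2
  simp_rw [h1 (M _)]
  rw [← h1]
  exact h2

/-- For the Lagrangian flow of a divergence-free `C¹` velocity field, the
spatial Jacobian matrix is invertible, its inverse equals its adjugate, and the entries of the
inverse are given by `δ_{ij}` plus the cofactor polynomial evaluated at `J - I`. -/
theorem flow_jacobian_inverse_eq_adjugate
    (N : ℕ) (hN : 1 ≤ N)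
    (v : ℝ × (Fin N → ℝ) → (Fin N → ℝ))
    (hv : ContDiff ℝ 1 v)
    (hdiv : ∀ t : ℝ, ∀ x₀ : Fin N → ℝ,
      ∑ i : Fin N, fderiv ℝ v (t, x₀) ((0 : ℝ), Pi.single i 1) i = 0)
    (x : ℝ × (Fin N → ℝ) → (Fin N → ℝ))
    (hx : ContDiff ℝ 2 x)
    (hflow : ∀ t : ℝ, ∀ y : Fin N → ℝ,
      fderiv ℝ x (t, y) ((1 : ℝ), 0) = v (t, x (t, y)))
    (hinit : ∀ y : Fin N → ℝ, x (0, y) = y)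
    -- the cofactor polynomials
    (Q : Fin N → Fin N → MvPolynomial (Fin N × Fin N) ℝ)
    (hQconst : ∀ i j : Fin N, MvPolynomial.constantCoeff (Q i j) = 0)
    (hQadj : ∀ i j : Fin N, ∀ M : Matrix (Fin N) (Fin N) ℝ,
      Matrix.adjugate (1 + M) i j =
        (if i = j then (1 : ℝ) else 0) +
          MvPolynomial.eval (fun v : Fin N × Fin N => M v.1 v.2) (Q i j)) :
    ∀ t : ℝ, ∀ y : Fin N → ℝ, ∀ J : Matrix (Fin N) (Fin N) ℝ,
      J = (Matrix.of fun m ℓ : Fin N =>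
        fderiv ℝ x (t, y) ((0 : ℝ), Pi.single ℓ 1) m) →
      IsUnit J ∧ J⁻¹ = Matrix.adjugate J ∧
      ∀ i j : Fin N,
        J⁻¹ i j =
          (if i = j then (1 : ℝ) else 0) +
            MvPolynomial.eval (fun v : Fin N × Fin N => (J - 1) v.1 v.2) (Q i j) := by
  have key : ∀ t : ℝ, ∀ y : Fin N → ℝ, (Matrix.of fun m ℓ : Fin N =>
        fderiv ℝ x (t, y) ((0 : ℝ), Pi.single ℓ 1) m).det = 1 := by
    intro t y
    set M : ℝ → Matrix (Fin N) (Fin N) ℝ := fun s => Matrix.of fun m ℓ : Fin N =>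
        fderiv ℝ x (s, y) ((0 : ℝ), Pi.single ℓ 1) m with hM
    have hxd : Differentiable ℝ x := hx.differentiable (by norm_num)
    have hvd : Differentiable ℝ v := hv.differentiable (by norm_num)
    have hfd : Differentiable ℝ (fderiv ℝ x) :=
      (hx.fderiv_right (m := 1) (by norm_num)).differentiable (by norm_num)
    have hder : ∀ s, HasDerivAt (fun s => (M s).det) 0 s := by
      intro s
      have hsym : IsSymmSndFDerivAt ℝ x (s, y) :=
        hx.contDiffAt.isSymmSndFDerivAt (by simp)
      set A : Matrix (Fin N) (Fin N) ℝ := Matrix.of fun m k =>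
        fderiv ℝ v (s, x (s, y)) ((0 : ℝ), Pi.single k 1) m with hA
      set M' : Matrix (Fin N) (Fin N) ℝ := Matrix.of fun m ℓ =>
        fderiv ℝ (fderiv ℝ x) (s, y) ((1 : ℝ), 0) ((0 : ℝ), Pi.single ℓ 1) m with hM'
      have e1 : ∀ i j, HasDerivAt (fun s => M s i j) (M' i j) s := by
        intro i j
        have c1 : HasDerivAt (fun s : ℝ => (s, y)) ((1 : ℝ), (0 : Fin N → ℝ)) s :=
          (hasDerivAt_id s).prodMk (hasDerivAt_const s y)
        have c2 := (hfd (s, y)).hasFDerivAt.comp_hasDerivAt s c1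
        have c3 := c2.clm_apply (hasDerivAt_const s ((0 : ℝ), (Pi.single j 1 : Fin N → ℝ)))
        have c4 := (hasDerivAt_pi.1 c3) i
        simpa [hM, hM'] using c4
      have e2 : M' = A * M s := by
        ext m ℓ
        have d1 : HasFDerivAt (fun p => fderiv ℝ x p ((1 : ℝ), (0 : Fin N → ℝ)))
            ((fderiv ℝ (fderiv ℝ x) (s, y)).flip ((1 : ℝ), 0)) (s, y) := by
          simpa using (hfd (s, y)).hasFDerivAt.clm_apply
            (hasFDerivAt_const ((1 : ℝ), (0 : Fin N → ℝ)) (s, y))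
        have d2 : (fun p => fderiv ℝ x p ((1 : ℝ), (0 : Fin N → ℝ))) = fun p => v (p.1, x p) := by
          funext p
          exact hflow p.1 p.2
        rw [d2] at d1
        have d3 : HasFDerivAt (fun p : ℝ × (Fin N → ℝ) => v (p.1, x p))
            ((fderiv ℝ v (s, x (s, y))).comp
              ((ContinuousLinearMap.fst ℝ ℝ (Fin N → ℝ)).prod (fderiv ℝ x (s, y)))) (s, y) :=
          HasFDerivAt.comp (s, y) (g := v) (f := fun p : ℝ × (Fin N → ℝ) => (p.1, x p))
            (hvd (s, x (s, y))).hasFDerivAt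
            (hasFDerivAt_fst.prodMk (hxd (s, y)).hasFDerivAt)
        have d4 := d1.unique d3
        have d5 := congrFun (congrArg (fun L => L ((0 : ℝ), (Pi.single ℓ 1 : Fin N → ℝ))) d4) m
        have d6 : M' m ℓ = fderiv ℝ v (s, x (s, y))
            ((0 : ℝ), fderiv ℝ x (s, y) ((0 : ℝ), Pi.single ℓ 1)) m := by
          rw [hM', Matrix.of_apply, hsym.eq]
          simpa using d5
        rw [d6]
        generalize hw : fderiv ℝ x (s, y) ((0 : ℝ), Pi.single ℓ 1) = w
        have d7 : ((0 : ℝ), w) = ∑ k, w k • ((0 : ℝ), (Pi.single k 1 : Fin N → ℝ)) := by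
          ext k
          · simp [Prod.fst_sum]
          · simp [Prod.snd_sum, Finset.sum_apply, Pi.single_apply]
        rw [d7, map_sum, Finset.sum_apply, Matrix.mul_apply]
        refine Finset.sum_congr rfl fun k _ => ?_
        rw [map_smul]
        simp only [hA, hM, hw, Matrix.of_apply, Pi.smul_apply, smul_eq_mul, mul_comm]
      have e3 : A.trace = 0 := by
        simpa [Matrix.trace, hA] using hdiv s (x (s, y))
      have e4 := hasDerivAt_det_aux M M' A s e1 e2
      rwa [e3, zero_mul] at e4
    have hconst := is_const_of_deriv_eq_zero (fun s => (hder s).differentiableAt)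
      (fun s => (hder s).deriv) t 0
    have h0 : M 0 = 1 := by
      ext m ℓ
      have c1 : HasFDerivAt (fun z : Fin N → ℝ => x (0, z))
          ((fderiv ℝ x (0, y)).comp (ContinuousLinearMap.inr ℝ ℝ (Fin N → ℝ))) y :=
        HasFDerivAt.comp y (g := x) (f := fun z : Fin N → ℝ => ((0 : ℝ), z))
          (hxd (0, y)).hasFDerivAt (hasFDerivAt_prodMk_right 0 y)
      simp_rw [hinit] at c1
      have c2 := c1.unique (hasFDerivAt_id y)
      have c3 := congrFun (congrArg (fun L => L (Pi.single ℓ 1 : Fin N → ℝ)) c2) m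
      simpa [hM, Matrix.one_apply, Pi.single_apply] using c3
    change (M t).det = 1
    rw [hconst, h0, Matrix.det_one]
  intro t y J hJ
  have hdet : J.det = 1 := by rw [hJ]; exact key t y
  have hinv : J⁻¹ = Matrix.adjugate J := by
    rw [Matrix.inv_def, hdet]
    simp
  refine ⟨?_, hinv, ?_⟩
  · rw [Matrix.isUnit_iff_isUnit_det, hdet]
    exact isUnit_one
  · intro i j
    rw [hinv, ← hQadj i j (J - 1), add_sub_cancel]
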